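/- arXiv:2007.15259 — 2 statements merged into one kernel-verified Lean document; each statement's English description precedes it below -/
import Mathlib

section
/- For ν > −1, ε > 0, λ ∈ ℝ and x > 0, the Laplace-type Bessel integral holds: ∫₀^∞ J_ν(√x · u) · u^{ν+1} · e^{−(ε − iλ) u} du = (2^{ν+1} Γ(ν + 3/2) / √π) · x^{ν/2} (ε − iλ) / ((ε − iλ)² + x)^{ν+3/2}, where the right side is defined by analytic continuation in ε from ε large. -/
open Real MeasureTheory

/-- The Bessel function of the first kind of order `ν`, defined by its
power series `J_ν(t) = ∑_m (-1)^m / (m! Γ(m+ν+1)) (t/2)^{2m+ν}`. -/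
noncomputable def besselJ (ν t : ℝ) : ℝ :=
  ∑' m : ℕ, ((-1) ^ m / (m.factorial * Real.Gamma (m + ν + 1)))
    * (t / 2) ^ (2 * m) * (t / 2) ^ ν

/-- Coefficients of the entire function `z ↦ ∑ (-z)^m / (m! Γ(m+ν+1))`. -/
noncomputable def besselCoeff (ν : ℝ) (m : ℕ) : ℝ :=
  (-1) ^ m / (m.factorial * Real.Gamma (m + ν + 1))

/-- The Bessel–Clifford function `z ↦ ∑ (-z)^m / (m! Γ(m+ν+1))`, for which
`J_ν(t) = (t/2)^ν besselEntire ν (t²/4)`. -/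
noncomputable def besselEntire (ν z : ℝ) : ℝ := ∑' m : ℕ, besselCoeff ν m * z ^ m

lemma gamma_nat_add_pos {ν : ℝ} (hν : -1 < ν) (m : ℕ) : 0 < Real.Gamma (m + ν + 1) :=
  Real.Gamma_pos_of_pos (by have : (0 : ℝ) ≤ m := m.cast_nonneg; linarith)

lemma gamma_nat_add_succ {ν : ℝ} (hν : -1 < ν) (m : ℕ) :
    Real.Gamma ((m + 1 : ℕ) + ν + 1) = (m + ν + 1) * Real.Gamma (m + ν + 1) := by
  have : (0 : ℝ) ≤ m := m.cast_nonneg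
  rw [← Real.Gamma_add_one (by linarith)]
  push_cast
  ring_nf

lemma exists_abs_besselCoeff_le {ν : ℝ} (hν : -1 < ν) :
    ∃ C : ℝ, 0 ≤ C ∧ ∀ m, |besselCoeff ν m| ≤ C / m.factorial := by
  have key : ∀ m : ℕ, Real.Gamma ((1 : ℕ) + ν + 1) ≤ Real.Gamma ((m + 1 : ℕ) + ν + 1) := by
    intro m
    induction m with
    | zero => simp
    | succ k ih =>
      refine ih.trans ?_
      rw [gamma_nat_add_succ hν (k + 1)]
      have := gamma_nat_add_pos hν (k + 1)
      have hk : (0 : ℝ) ≤ k := k.cast_nonneg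
      refine le_mul_of_one_le_left this.le ?_
      push_cast
      linarith
  have h0 := gamma_nat_add_pos hν 0
  have h1 := gamma_nat_add_pos hν 1
  refine ⟨(Real.Gamma ((0 : ℕ) + ν + 1))⁻¹ + (Real.Gamma ((1 : ℕ) + ν + 1))⁻¹, by positivity, ?_⟩
  intro m
  have hm := gamma_nat_add_pos hν m
  have hf : (0 : ℝ) < m.factorial := by positivity
  rw [besselCoeff, abs_div, abs_pow, abs_neg, abs_one, one_pow, abs_of_pos (by positivity),
    one_div, mul_inv, mul_comm, div_eq_mul_inv]
  gcongr
  cases m with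
  | zero => exact le_add_of_nonneg_right (by positivity)
  | succ k => exact (inv_anti₀ h1 (key k)).trans (le_add_of_nonneg_left (by positivity))

lemma summable_besselCoeff_mul_pow {ν : ℝ} (hν : -1 < ν) (z : ℝ) :
    Summable fun m ↦ besselCoeff ν m * z ^ m := by
  obtain ⟨C, -, hC⟩ := exists_abs_besselCoeff_le hν
  refine .of_norm_bounded ((Real.summable_pow_div_factorial |z|).mul_left C) fun m ↦ ?_
  rw [Real.norm_eq_abs, abs_mul, abs_pow]
  calc _ ≤ C / m.factorial * |z| ^ m := by gcongr; exact hC m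
    _ = _ := by ring

lemma succ_mul_besselCoeff (ν : ℝ) (m : ℕ) :
    (m + 1) * besselCoeff ν (m + 1) = -besselCoeff (ν + 1) m := by
  have : (m : ℝ) + 1 ≠ 0 := by positivity
  simp only [besselCoeff, Nat.factorial_succ, pow_succ]
  push_cast
  rw [show (m : ℝ) + (ν + 1) + 1 = m + 1 + ν + 1 by ring]
  field_simp

lemma besselCoeff_recurrence {ν : ℝ} (hν : -1 < ν) (m : ℕ) :
    besselCoeff ν (m + 1) = (ν + 1) * besselCoeff (ν + 1) (m + 1) - besselCoeff (ν + 2) m := by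
  have h1 := gamma_nat_add_pos hν (m + 1)
  have h2 := gamma_nat_add_succ hν (m + 1)
  have hm : (0 : ℝ) ≤ m := m.cast_nonneg
  simp only [besselCoeff, Nat.factorial_succ, pow_succ]
  rw [show ((m + 1 : ℕ) : ℝ) + (ν + 1) + 1 = ((m + 1 + 1 : ℕ) : ℝ) + ν + 1 by push_cast; ring,
    show (m : ℝ) + (ν + 2) + 1 = ((m + 1 + 1 : ℕ) : ℝ) + ν + 1 by push_cast; ring, h2]
  have h3 : ((m + 1 : ℕ) : ℝ) + ν + 1 ≠ 0 := by push_cast; linarith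
  have h4 : ((m + 1 : ℕ) : ℝ) ≠ 0 := by positivity
  generalize Real.Gamma (((m + 1 : ℕ) : ℝ) + ν + 1) = G at *
  push_cast at *
  field_simp
  ring

lemma besselCoeff_zero_recurrence {ν : ℝ} (hν : -1 < ν) :
    besselCoeff ν 0 = (ν + 1) * besselCoeff (ν + 1) 0 := by
  have h1 := gamma_nat_add_pos hν 0
  have h2 := gamma_nat_add_succ hν 0
  have h3 : ν + 1 ≠ 0 := by linarith
  simp only [besselCoeff]
  rw [show ((0 : ℕ) : ℝ) + (ν + 1) + 1 = ((0 + 1 : ℕ) : ℝ) + ν + 1 by push_cast; ring, h2]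
  simp at h1 ⊢
  field_simp

lemma besselEntire_recurrence {ν : ℝ} (hν : -1 < ν) (z : ℝ) :
    besselEntire ν z = (ν + 1) * besselEntire (ν + 1) z - z * besselEntire (ν + 2) z := by
  have s0 := summable_besselCoeff_mul_pow hν z
  have s1 := summable_besselCoeff_mul_pow (ν := ν + 1) (by linarith) z
  have s2 := summable_besselCoeff_mul_pow (ν := ν + 2) (by linarith) z
  have s1' := (summable_nat_add_iff 1).2 s1
  simp only [besselEntire]
  rw [s0.tsum_eq_zero_add, s1.tsum_eq_zero_add, besselCoeff_zero_recurrence hν, mul_add,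
    ← tsum_mul_left, ← tsum_mul_left, add_sub_assoc,
    ← (s1'.mul_left (ν + 1)).tsum_sub (s2.mul_left z)]
  congr 1
  · ring
  · refine tsum_congr fun m ↦ ?_
    rw [besselCoeff_recurrence hν]
    ring

lemma hasDerivAt_besselEntire {ν : ℝ} (hν : -1 < ν) (z : ℝ) :
    HasDerivAt (besselEntire ν) (-besselEntire (ν + 1) z) z := by
  obtain ⟨C, hC0, hC⟩ := exists_abs_besselCoeff_le hν
  set R := |z| + 1
  have hR : 0 ≤ R := by positivity
  have hsum : Summable fun m : ℕ ↦ C / m.factorial * (m * R ^ (m - 1)) := by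
    rw [← summable_nat_add_iff 1]
    refine ((Real.summable_pow_div_factorial R).mul_left C).congr fun m ↦ ?_
    have : (m : ℝ) + 1 ≠ 0 := by positivity
    rw [Nat.factorial_succ]
    simp only [Nat.add_sub_cancel]
    push_cast
    field_simp
  have h := hasDerivAt_tsum_of_isPreconnected (g := fun m y ↦ besselCoeff ν m * y ^ m)
    (g' := fun m y ↦ besselCoeff ν m * (m * y ^ (m - 1))) (t := Metric.ball 0 R)
    (y₀ := z) (y := z) hsum Metric.isOpen_ball (convex_ball _ _).isPreconnected
    (fun m y _ ↦ (hasDerivAt_pow m y).const_mul _) (fun m y hy ↦ ?_) (by simp [R])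
    (summable_besselCoeff_mul_pow hν z) (by simp [R])
  · convert! h using 1
    rw [tsum_eq_zero_add' (f := fun m ↦ besselCoeff ν m * (m * z ^ (m - 1)))]
    · simp only [besselEntire, Nat.cast_zero, zero_mul, mul_zero, zero_add, ← tsum_neg]
      refine tsum_congr fun m ↦ ?_
      have := succ_mul_besselCoeff ν m
      simp only [Nat.add_sub_cancel]
      push_cast
      linear_combination -z ^ m * this
    · refine (summable_besselCoeff_mul_pow (ν := ν + 1) (by linarith) z).neg.congr fun m ↦ ?_
      have := succ_mul_besselCoeff ν m
      simp only [Nat.add_sub_cancel]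
      push_cast
      linear_combination -z ^ m * this
  · rw [mem_ball_zero_iff, Real.norm_eq_abs] at hy
    rw [Real.norm_eq_abs, abs_mul, abs_mul, abs_pow, Nat.abs_cast]
    gcongr
    exact hC m

lemma continuous_besselEntire {ν : ℝ} (hν : -1 < ν) : Continuous (besselEntire ν) :=
  continuous_iff_continuousAt.2 fun z ↦ (hasDerivAt_besselEntire hν z).continuousAt

lemma abs_besselEntire_le {ν : ℝ} (hν : -(1 / 2) ≤ ν) {z : ℝ} (hz : 0 ≤ z) :
    |besselEntire ν z| ≤ |besselEntire ν 0| := by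
  have h0 : -1 < ν := by linarith
  have h1 : -1 < ν + 1 := by linarith
  have hd : ∀ y, HasDerivAt (fun y ↦ besselEntire ν y ^ 2 + y * besselEntire (ν + 1) y ^ 2)
      (-(2 * ν + 1) * besselEntire (ν + 1) y ^ 2) y := fun y ↦ by
    have e0 := (hasDerivAt_besselEntire h0 y).pow 2
    have e1 := (hasDerivAt_id y).mul ((hasDerivAt_besselEntire h1 y).pow 2)
    convert! e0.add e1 using 1
    have := besselEntire_recurrence h0 y
    rw [show ν + 1 + 1 = ν + 2 by ring]
    simp
    linear_combination (2 * besselEntire (ν + 1) y) * this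
  have hanti := antitone_of_hasDerivAt_nonpos hd fun y ↦ by
    have := sq_nonneg (besselEntire (ν + 1) y)
    simp only [Pi.zero_apply]
    nlinarith
  have := hanti hz
  simp only [zero_mul, add_zero] at this
  exact sq_le_sq.1 ((le_add_of_nonneg_right (by positivity)).trans this)

lemma exists_abs_besselEntire_le {ν : ℝ} (hν : -1 < ν) :
    ∃ A B : ℝ, ∀ z, 0 ≤ z → |besselEntire ν z| ≤ A + B * z := by
  refine ⟨(ν + 1) * |besselEntire (ν + 1) 0|, |besselEntire (ν + 2) 0|, fun z hz ↦ ?_⟩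
  have h1 := abs_besselEntire_le (ν := ν + 1) (by linarith) hz
  have h2 := abs_besselEntire_le (ν := ν + 2) (by linarith) hz
  rw [besselEntire_recurrence hν z]
  refine (abs_sub _ _).trans ?_
  rw [abs_mul, abs_mul, abs_of_nonneg hz, abs_of_pos (by linarith : 0 < ν + 1), mul_comm z]
  gcongr
  linarith

lemma norm_laplace_kernel (h u : ℝ) (s : ℂ) :
    ‖(h : ℂ) * Complex.exp (-s * u)‖ = |h * Real.exp (-(s.re * u))| := by
  rw [norm_mul, Complex.norm_exp, Complex.norm_real, abs_mul, Real.abs_exp]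
  simp

lemma differentiableOn_laplace {h : ℝ → ℝ}
    (hint : ∀ δ : ℝ, 0 < δ → IntegrableOn (fun u ↦ h u * Real.exp (-(δ * u))) (Set.Ioi 0)) :
    DifferentiableOn ℂ
      (fun s : ℂ ↦ ∫ u in Set.Ioi (0 : ℝ), (h u : ℂ) * Complex.exp (-s * u)) {s | 0 < s.re} := by
  intro s₀ hs₀
  have hs₀ : 0 < s₀.re := hs₀
  set σ := s₀.re
  have hmeas : AEStronglyMeasurable h (volume.restrict (Set.Ioi 0)) := by
    have h1 := (hint 1 one_pos).aestronglyMeasurable.mul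
      (Continuous.aestronglyMeasurable (f := fun u : ℝ ↦ Real.exp u) (by fun_prop))
    refine h1.congr (.of_forall fun u ↦ ?_)
    simp [mul_assoc, ← Real.exp_add]
  have hmeasC : AEStronglyMeasurable (fun u ↦ (h u : ℂ)) (volume.restrict (Set.Ioi 0)) :=
    Complex.continuous_ofReal.comp_aestronglyMeasurable hmeas
  have hker : ∀ s : ℂ, AEStronglyMeasurable (fun u : ℝ ↦ (h u : ℂ) * Complex.exp (-s * u))
      (volume.restrict (Set.Ioi 0)) := fun s ↦
    hmeasC.mul (Continuous.aestronglyMeasurable (by fun_prop))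
  refine (hasDerivAt_integral_of_dominated_loc_of_deriv_le
    (μ := volume.restrict (Set.Ioi 0)) (s := {s : ℂ | σ / 2 < s.re})
    (F := fun s u ↦ (h u : ℂ) * Complex.exp (-s * u))
    (F' := fun s u ↦ (h u : ℂ) * Complex.exp (-s * u) * (-u)) (x₀ := s₀)
    (bound := fun u ↦ 4 / σ * |h u * Real.exp (-(σ / 4 * u))|)
    ((isOpen_lt continuous_const Complex.continuous_re).mem_nhds
      (show σ / 2 < s₀.re from half_lt_self hs₀))
    (.of_forall hker) ?_ ?_ ?_ ?_ ?_).2.differentiableAt.differentiableWithinAt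
  · refine ((hint σ hs₀).norm.mono' (hker s₀) (.of_forall fun u ↦ ?_))
    rw [norm_laplace_kernel, Real.norm_eq_abs]
  · exact (hker s₀).mul (Continuous.aestronglyMeasurable (by fun_prop))
  · refine (ae_restrict_iff' measurableSet_Ioi).2 (.of_forall fun u hu s hs ↦ ?_)
    have hu : 0 < u := hu
    have hs : σ / 2 < s.re := hs
    rw [norm_mul, norm_laplace_kernel, norm_neg, Complex.norm_real, Real.norm_eq_abs,
      abs_of_pos hu, abs_mul, abs_mul, Real.abs_exp, Real.abs_exp]
    have h1 : σ / 4 * u ≤ Real.exp (σ / 4 * u) := by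
      linarith [Real.add_one_le_exp (σ / 4 * u)]
    have h2 : Real.exp (-(s.re * u)) * Real.exp (σ / 4 * u) ≤ Real.exp (-(σ / 4 * u)) := by
      rw [← Real.exp_add, Real.exp_le_exp]
      nlinarith
    have h3 : Real.exp (-(s.re * u)) * (σ / 4 * u) ≤ Real.exp (-(σ / 4 * u)) :=
      (mul_le_mul_of_nonneg_left h1 (Real.exp_pos _).le).trans h2
    calc |h u| * Real.exp (-(s.re * u)) * u
        = 4 / σ * (|h u| * (Real.exp (-(s.re * u)) * (σ / 4 * u))) := by field_simp
      _ ≤ _ := by gcongr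
  · exact (hint (σ / 4) (by positivity)).abs.const_mul _
  · refine .of_forall fun u s _ ↦ ?_
    have := ((hasDerivAt_neg s).mul_const (u : ℂ)).cexp.const_mul (h u : ℂ)
    convert! this using 1
    ring

lemma integrableOn_rpow_mul_exp_neg_mul {a δ : ℝ} (ha : -1 < a) (hδ : 0 < δ) :
    IntegrableOn (fun u : ℝ ↦ u ^ a * Real.exp (-(δ * u))) (Set.Ioi 0) := by
  simpa using integrableOn_rpow_mul_exp_neg_mul_rpow ha one_pos hδ

lemma integrableOn_besselEntire {ν x δ : ℝ} (hν : -1 < ν) (hx : 0 ≤ x) (hδ : 0 < δ) :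
    IntegrableOn (fun u : ℝ ↦ u ^ (2 * ν + 1) * besselEntire ν (x * u ^ 2 / 4)
      * Real.exp (-(δ * u))) (Set.Ioi 0) := by
  obtain ⟨A, B, hAB⟩ := exists_abs_besselEntire_le hν
  have h1 := (integrableOn_rpow_mul_exp_neg_mul (a := 2 * ν + 1) (by linarith) hδ).const_mul A
  have h2 := (integrableOn_rpow_mul_exp_neg_mul (a := 2 * ν + 1 + 2) (by linarith) hδ).const_mul
    (B * x / 4)
  refine (h1.add h2).mono' ?_ ?_
  · refine Measurable.aestronglyMeasurable ?_
    have := (continuous_besselEntire hν).measurable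
    fun_prop
  · refine (ae_restrict_iff' measurableSet_Ioi).2 (.of_forall fun u hu ↦ ?_)
    have hu : 0 < u := hu
    rw [norm_mul, norm_mul, Real.norm_of_nonneg (Real.exp_pos _).le,
      Real.norm_of_nonneg (Real.rpow_nonneg hu.le _), Real.norm_eq_abs]
    simp only [Pi.add_apply]
    rw [Real.rpow_add hu (2 * ν + 1) 2, Real.rpow_two]
    calc _ ≤ u ^ (2 * ν + 1) * (A + B * (x * u ^ 2 / 4)) * Real.exp (-(δ * u)) := by
          gcongr
          exact hAB _ (div_nonneg (mul_nonneg hx (sq_nonneg u)) (by norm_num))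
      _ = _ := by ring

lemma choose_mul_gamma {b : ℝ} (hb : 0 < b) (m : ℕ) :
    Ring.choose (b + m - 1) m = Real.Gamma (m + b) / (m.factorial * Real.Gamma b) := by
  have h1 : (m.factorial : ℝ) * Ring.choose (b + m - 1) m = (ascPochhammer ℝ m).eval b := by
    rw [← Ring.multichoose_eq, ← nsmul_eq_mul, Ring.factorial_nsmul_multichoose_eq_ascPochhammer,
      Polynomial.ascPochhammer_smeval_cast, Polynomial.ascPochhammer_smeval_eq_eval]
  have h2 : ∀ n : ℕ, (ascPochhammer ℝ n).eval b * Real.Gamma b = Real.Gamma (n + b) := by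
    intro n
    induction n with
    | zero => simp
    | succ k ih =>
      rw [ascPochhammer_succ_eval, mul_right_comm, ih]
      have : (k : ℝ) + b ≠ 0 := by positivity
      push_cast
      rw [add_right_comm, Real.Gamma_add_one this]
      ring
  have := (Real.Gamma_pos_of_pos hb).ne'
  rw [← h2, ← h1]
  field_simp

lemma hasSum_gamma_binomial {b y : ℝ} (hb : 0 < b) (hy : |y| < 1) :
    HasSum (fun m : ℕ ↦ Real.Gamma (m + b) / m.factorial * y ^ m)
      (Real.Gamma b / (1 - y) ^ b) := by
  have h := (Real.one_div_one_sub_rpow_hasFPowerSeriesOnBall_zero b).hasSum_sub (y := y)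
    (by simpa [← ofReal_norm] using hy)
  have := (Real.Gamma_pos_of_pos hb).ne'
  convert! h.mul_left (Real.Gamma b) using 1
  · ext m
    simp [choose_mul_gamma hb]
    field_simp
  · ring

lemma gamma_duplication_coeff {ν : ℝ} (hν : -1 < ν) (m : ℕ) :
    Real.Gamma (2 * m + 2 * ν + 2) / (m.factorial * Real.Gamma (m + ν + 1))
      = 2 ^ (2 * ν + 1) / √π * (Real.Gamma (m + (ν + 3 / 2)) / m.factorial) * 4 ^ m := by
  have h := Real.Gamma_mul_Gamma_add_half (m + ν + 1)
  have h1 := gamma_nat_add_pos hν m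
  have h2 : (2 : ℝ) ^ (1 - 2 * (m + ν + 1)) = (2 ^ (2 * ν + 1) * 4 ^ m)⁻¹ := by
    rw [show (4 : ℝ) ^ m = 2 ^ (2 * m : ℝ) by
      rw [Real.rpow_mul (by norm_num), Real.rpow_natCast]; norm_num,
      ← Real.rpow_add (by norm_num), ← Real.rpow_neg (by norm_num)]
    ring_nf
  rw [h2, show 2 * (m + ν + 1) = 2 * m + 2 * ν + 2 by ring,
    show m + ν + 1 + 1 / 2 = m + (ν + 3 / 2) by ring] at h
  have h3 : 0 < √π := by positivity
  have h4 : (0 : ℝ) < 2 ^ (2 * ν + 1) := by positivity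
  field_simp at h ⊢
  linarith

lemma integral_besselEntire_term {ν x r : ℝ} (hν : -1 < ν) (hr : 0 < r) (m : ℕ) :
    ∫ u in Set.Ioi (0 : ℝ), u ^ (2 * m + 2 * ν + 1) * Real.exp (-(r * u))
      * (x ^ m / (4 ^ m * (m.factorial * Real.Gamma (m + ν + 1))))
      = 2 ^ (2 * ν + 1) / √π * r ^ (-(2 * ν + 2))
        * (Real.Gamma (m + (ν + 3 / 2)) / m.factorial * (x / r ^ 2) ^ m) := by
  have hm : (0 : ℝ) ≤ m := m.cast_nonneg
  have hG := gamma_duplication_coeff hν m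
  have hI := Real.integral_rpow_mul_exp_neg_mul_Ioi (a := 2 * m + 2 * ν + 2) (by linarith) hr
  rw [show 2 * m + 2 * ν + 2 - 1 = 2 * m + 2 * ν + 1 by ring] at hI
  have hpow : (1 / r) ^ (2 * m + 2 * ν + 2) = r ^ (-(2 * ν + 2)) / (r ^ 2) ^ m := by
    rw [one_div, Real.inv_rpow hr.le, ← Real.rpow_neg hr.le, ← pow_mul, ← Real.rpow_natCast,
      ← Real.rpow_sub hr]
    push_cast
    ring_nf
  rw [integral_mul_const, hI, hpow]
  calc _ = r ^ (-(2 * ν + 2)) / (r ^ 2) ^ m * x ^ m / 4 ^ m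
        * (Real.Gamma (2 * m + 2 * ν + 2) / (m.factorial * Real.Gamma (m + ν + 1))) := by
        field_simp
    _ = _ := by
        rw [hG, div_pow]
        field_simp

lemma integral_besselEntire_of_large {ν x r : ℝ} (hν : -1 < ν) (hx : 0 ≤ x) (hr : 0 < r)
    (hxr : x < r ^ 2) :
    ∫ u in Set.Ioi (0 : ℝ), u ^ (2 * ν + 1) * besselEntire ν (x * u ^ 2 / 4) * Real.exp (-(r * u))
      = 2 ^ (2 * ν + 1) * Real.Gamma (ν + 3 / 2) / √π * r / (r ^ 2 + x) ^ (ν + 3 / 2) := by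
  have hb : 0 < ν + 3 / 2 := by linarith
  set K := 2 ^ (2 * ν + 1) / √π * r ^ (-(2 * ν + 2))
  have hy : |x / r ^ 2| < 1 := by
    rwa [abs_of_nonneg (by positivity), div_lt_one (by positivity)]
  set T : ℕ → ℝ → ℝ := fun m u ↦ u ^ (2 * m + 2 * ν + 1) * Real.exp (-(r * u))
      * ((-x) ^ m / (4 ^ m * (m.factorial * Real.Gamma (m + ν + 1))))
  have hT : ∀ m, Integrable (T m) (volume.restrict (Set.Ioi 0)) := fun m ↦ by
    have hm : (0 : ℝ) ≤ m := m.cast_nonneg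
    exact (integrableOn_rpow_mul_exp_neg_mul (by linarith) hr).mul_const _
  have hnorm : ∀ m, ∫ u in Set.Ioi (0 : ℝ), ‖T m u‖
      = K * (Real.Gamma (m + (ν + 3 / 2)) / m.factorial * (x / r ^ 2) ^ m) := fun m ↦ by
    rw [← integral_besselEntire_term hν hr m]
    refine setIntegral_congr_fun measurableSet_Ioi fun u hu ↦ ?_
    have hu : 0 < u := hu
    have := gamma_nat_add_pos hν m
    simp only [T, norm_mul, norm_div, norm_pow, norm_neg]
    rw [Real.norm_of_nonneg (Real.rpow_nonneg hu.le _), Real.norm_of_nonneg (Real.exp_pos _).le,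
      Real.norm_of_nonneg hx, Real.norm_of_nonneg this.le]
    simp
  have hsum := hasSum_integral_of_summable_integral_norm hT (by
    simp_rw [hnorm]
    exact (hasSum_gamma_binomial hb hy).summable.mul_left K)
  simp_rw [T, integral_besselEntire_term hν hr, neg_div] at hsum
  have hval := hsum.unique
    ((hasSum_gamma_binomial hb (y := -(x / r ^ 2)) (by rwa [abs_neg])).mul_left K)
  have hpow : (1 - -(x / r ^ 2)) ^ (ν + 3 / 2)
      = (r ^ 2 + x) ^ (ν + 3 / 2) * (r ^ (-(2 * ν + 2)) / r) := by
    rw [show 1 - -(x / r ^ 2) = (r ^ 2 + x) / r ^ 2 by field_simp; ring,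
      Real.div_rpow (by positivity) (by positivity), ← Real.rpow_natCast, ← Real.rpow_mul hr.le,
      div_eq_mul_inv, ← Real.rpow_neg hr.le, ← Real.rpow_sub_one hr.ne']
    push_cast
    ring_nf
  rw [hpow] at hval
  calc _ = ∫ u in Set.Ioi (0 : ℝ), ∑' m, T m u := by
        refine setIntegral_congr_fun measurableSet_Ioi fun u hu ↦ ?_
        have hu : 0 < u := hu
        simp only [besselEntire, T]
        rw [← tsum_mul_left, ← tsum_mul_right]
        refine tsum_congr fun m ↦ ?_
        rw [add_assoc, Real.rpow_add hu (2 * m), show u ^ (2 * m : ℝ) = (u ^ 2) ^ m by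
          rw [← pow_mul, ← Real.rpow_natCast]; push_cast; rfl, besselCoeff, neg_pow x, div_pow,
          mul_pow]
        field_simp
    _ = _ := by
        refine hval.trans ?_
        have h1 : 0 < r ^ (-(2 * ν + 2)) := by positivity
        have h2 : 0 < (r ^ 2 + x) ^ (ν + 3 / 2) := by positivity
        simp only [K]
        field_simp

lemma sq_add_mem_slitPlane {s : ℂ} (hs : 0 < s.re) {x : ℝ} (hx : 0 ≤ x) :
    s ^ 2 + x ∈ Complex.slitPlane := by
  rw [Complex.mem_slitPlane_iff]
  by_cases h : s.im = 0
  · left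
    simp [pow_two, h]
    positivity
  · right
    have : s.re ≠ 0 := hs.ne'
    simp [pow_two, mul_comm s.im]
    grind

theorem integral_besselEntire_laplace {ν x : ℝ} (hν : -1 < ν) (hx : 0 ≤ x) {s : ℂ}
    (hs : 0 < s.re) :
    ∫ u in Set.Ioi (0 : ℝ), ((u ^ (2 * ν + 1) * besselEntire ν (x * u ^ 2 / 4) : ℝ) : ℂ)
        * Complex.exp (-s * u)
      = ((2 ^ (2 * ν + 1) * Real.Gamma (ν + 3 / 2) / √π : ℝ) : ℂ) * s
        / (s ^ 2 + x) ^ ((ν : ℂ) + 3 / 2) := by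
  have hopen : IsOpen {s : ℂ | 0 < s.re} := isOpen_lt continuous_const Complex.continuous_re
  have hL := (differentiableOn_laplace
    fun δ hδ ↦ integrableOn_besselEntire hν hx hδ).analyticOnNhd hopen
  have hR : AnalyticOnNhd ℂ (fun s : ℂ ↦ ((2 ^ (2 * ν + 1) * Real.Gamma (ν + 3 / 2) / √π : ℝ) : ℂ)
      * s / (s ^ 2 + x) ^ ((ν : ℂ) + 3 / 2)) {s : ℂ | 0 < s.re} := by
    refine DifferentiableOn.analyticOnNhd (fun z hz ↦ ?_) hopen
    have hz' := sq_add_mem_slitPlane hz hx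
    refine DifferentiableAt.differentiableWithinAt ?_
    refine DifferentiableAt.div (by fun_prop) (.cpow (by fun_prop) (by fun_prop) hz') ?_
    exact fun h ↦ Complex.slitPlane_ne_zero hz' (Complex.cpow_eq_zero_iff _ _ |>.1 h).1
  refine hL.eqOn_of_preconnected_of_frequently_eq hR
    (convex_halfSpace_re_gt 0).isPreconnected (z₀ := ((√x + 1 : ℝ) : ℂ)) ?_ ?_ hs
  · rw [Set.mem_ofPred_eq, Complex.ofReal_re]
    positivity
  · have hreal : ∃ᶠ r : ℝ in nhdsWithin (√x + 1) {√x + 1}ᶜ, √x < r := by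
      refine Filter.Eventually.frequently ?_
      exact nhdsWithin_le_nhds (lt_mem_nhds (lt_add_one _))
    have htend : Filter.Tendsto (fun r : ℝ ↦ (r : ℂ)) (nhdsWithin (√x + 1) {√x + 1}ᶜ)
        (nhdsWithin ((√x + 1 : ℝ) : ℂ) {((√x + 1 : ℝ) : ℂ)}ᶜ) :=
      (Complex.continuous_ofReal.continuousAt.tendsto).inf
        (Filter.tendsto_principal_principal.2 fun r hr ↦ by
          simpa only [Set.mem_compl_iff, Set.mem_singleton_iff, Complex.ofReal_inj] using hr)
    refine htend.frequently (hreal.mono fun r hr ↦ ?_)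
    have hr0 : 0 < r := (Real.sqrt_nonneg x).trans_lt hr
    have hv := integral_besselEntire_of_large hν hx hr0 ((Real.sqrt_lt' hr0).1 hr)
    have hb : (0 : ℝ) ≤ r ^ 2 + x := by positivity
    have hp : ((r : ℂ) ^ 2 + x) ^ ((ν : ℂ) + 3 / 2) = (((r ^ 2 + x) ^ (ν + 3 / 2) : ℝ) : ℂ) := by
      rw [Complex.ofReal_cpow hb]
      push_cast
      rfl
    rw [hp, ← Complex.ofReal_mul, ← Complex.ofReal_div, ← hv, ← integral_complex_ofReal]
    refine integral_congr_ae (.of_forall fun u ↦ ?_)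
    push_cast
    simp

lemma besselJ_eq (ν t : ℝ) : besselJ ν t = besselEntire ν (t ^ 2 / 4) * (t / 2) ^ ν := by
  rw [besselJ, besselEntire, ← tsum_mul_right]
  refine tsum_congr fun m ↦ ?_
  rw [besselCoeff, pow_mul]
  ring

theorem stmt7 (ν : ℝ) (hν : -1 < ν) (ε lam x : ℝ) (hε : 0 < ε) (hx : 0 < x) :
    ∫ u in Set.Ioi (0 : ℝ),
        (besselJ ν (Real.sqrt x * u) : ℂ) * (u : ℂ) ^ ((ν : ℂ) + 1)
          * Complex.exp (-((ε : ℂ) - Complex.I * lam) * u)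
      = (2 ^ ((ν : ℂ) + 1) * (Real.Gamma (ν + 3 / 2) : ℂ) / (Real.sqrt Real.pi : ℂ))
          * (x : ℂ) ^ ((ν : ℂ) / 2) * ((ε : ℂ) - Complex.I * lam)
          / (((ε : ℂ) - Complex.I * lam) ^ 2 + (x : ℂ)) ^ ((ν : ℂ) + 3 / 2) := by
  have hs : 0 < ((ε : ℂ) - Complex.I * lam).re := by simpa using hε
  generalize (ε : ℂ) - Complex.I * lam = s at hs ⊢
  have hint : ∀ u ∈ Set.Ioi (0 : ℝ),
      (besselJ ν (√x * u) : ℂ) * (u : ℂ) ^ ((ν : ℂ) + 1) * Complex.exp (-s * u)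
      = (((√x / 2) ^ ν : ℝ) : ℂ) * (((u ^ (2 * ν + 1) * besselEntire ν (x * u ^ 2 / 4) : ℝ) : ℂ)
        * Complex.exp (-s * u)) := fun u hu ↦ by
    have hu : 0 < u := hu
    have hpow : (u : ℂ) ^ ((ν : ℂ) + 1) = ((u ^ (ν + 1) : ℝ) : ℂ) := by
      rw [Complex.ofReal_cpow hu.le]
      push_cast
      rfl
    have hreal : besselJ ν (√x * u) * u ^ (ν + 1)
        = (√x / 2) ^ ν * (u ^ (2 * ν + 1) * besselEntire ν (x * u ^ 2 / 4)) := by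
      rw [besselJ_eq, mul_pow, Real.sq_sqrt hx.le, mul_div_right_comm √x u 2,
        Real.mul_rpow (by positivity) hu.le, show 2 * ν + 1 = ν + (ν + 1) by ring,
        Real.rpow_add hu ν (ν + 1)]
      ring
    rw [hpow, ← Complex.ofReal_mul, hreal, Complex.ofReal_mul, mul_assoc]
  rw [setIntegral_congr_fun measurableSet_Ioi hint, integral_const_mul,
    integral_besselEntire_laplace hν hx.le hs]
  have hconst : (√x / 2) ^ ν * (2 ^ (2 * ν + 1) * Real.Gamma (ν + 3 / 2) / √π)
      = 2 ^ (ν + 1) * Real.Gamma (ν + 3 / 2) / √π * x ^ (ν / 2) := by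
    rw [Real.div_rpow (by positivity) (by norm_num), Real.sqrt_eq_rpow, ← Real.rpow_mul hx.le,
      show 2 * ν + 1 = ν + (ν + 1) by ring, Real.rpow_add (by norm_num) ν,
      show 1 / 2 * ν = ν / 2 by ring]
    field_simp
  have h2 : (2 : ℂ) ^ ((ν : ℂ) + 1) = ((2 ^ (ν + 1) : ℝ) : ℂ) := by
    rw [Complex.ofReal_cpow (by norm_num)]
    push_cast
    rfl
  have hxp : (x : ℂ) ^ ((ν : ℂ) / 2) = ((x ^ (ν / 2) : ℝ) : ℂ) := by
    rw [Complex.ofReal_cpow hx.le]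
    push_cast
    rfl
  rw [h2, hxp, ← Complex.ofReal_mul, ← Complex.ofReal_div, ← Complex.ofReal_mul, ← hconst]
  push_cast
  ring
end

section
/- For ν > −1 and x, y, ε > 0, the Weber–Schafheitlin type identity holds: ∫₀^∞ J_ν(2√(xs)) J_ν(2√(ys)) e^{−εs} ds = (1/ε) exp(−(x+y)/ε) I_ν(2√(xy)/ε), where I_ν is the modified Bessel function of the first kind. -/
open Real MeasureTheory

/-- The modified Bessel function of the first kind of order `ν`. -/
noncomputable def besselI (ν t : ℝ) : ℝ :=
  ∑' m : ℕ, (1 / (m.factorial * Real.Gamma (m + ν + 1)))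
    * (t / 2) ^ (2 * m) * (t / 2) ^ ν

theorem sum_choose_mul_choose_div_Gamma (m n : ℕ) (ν : ℝ) (hν : -1 < ν) :
    ∑ k ∈ Finset.range (m + 1),
        (m.choose k : ℝ) * ((n.choose k : ℝ) * k.factorial / Real.Gamma (k + ν + 1))
      = Real.Gamma (m + n + ν + 1) / (Real.Gamma (m + ν + 1) * Real.Gamma (n + ν + 1)) := by
  induction m generalizing n ν with
  | zero =>
    have h1 : Real.Gamma (n + ν + 1) ≠ 0 :=
      (Real.Gamma_pos_of_pos (by have : (0 : ℝ) ≤ n := n.cast_nonneg; linarith)).ne'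
    simp
    field_simp
  | succ m ih =>
    have hm0 : (0 : ℝ) ≤ m := m.cast_nonneg
    have hn0 : (0 : ℝ) ≤ n := n.cast_nonneg
    have key : ∑ k ∈ Finset.range (m + 1 + 1),
        ((m + 1).choose k : ℝ) * ((n.choose k : ℝ) * k.factorial / Real.Gamma (k + ν + 1))
        = ∑ k ∈ Finset.range (m + 1),
          (m.choose k : ℝ) * ((n.choose k : ℝ) * k.factorial / Real.Gamma (k + ν + 1))
        + ∑ k ∈ Finset.range (m + 1), (m.choose k : ℝ) *
          ((n.choose (k + 1) : ℝ) * (k + 1).factorial / Real.Gamma (k + (ν + 1) + 1)) := by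
      have h2 : ∑ k ∈ Finset.range (m + 1),
          (m.choose k : ℝ) * ((n.choose k : ℝ) * k.factorial / Real.Gamma (k + ν + 1))
          = ∑ k ∈ Finset.range (m + 1 + 1),
          (m.choose k : ℝ) * ((n.choose k : ℝ) * k.factorial / Real.Gamma (k + ν + 1)) := by
        rw [Finset.sum_range_succ _ (m + 1)]
        simp
      rw [h2, Finset.sum_range_succ', Finset.sum_range_succ' _ (m + 1), add_right_comm (Finset.sum _ _),
        ← Finset.sum_add_distrib]
      congr 1
      · refine Finset.sum_congr rfl fun k _ => ?_
        rw [Nat.choose_succ_succ]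
        push_cast
        rw [show (k : ℝ) + (ν + 1) + 1 = k + 1 + ν + 1 by ring]
        ring
      · simp
    rw [key, ih n ν hν]
    have hG : Real.Gamma (m + 1 + ν + 1) = (m + ν + 1) * Real.Gamma (m + ν + 1) := by
      rw [← Real.Gamma_add_one (by linarith)]
      ring_nf
    have hG' : Real.Gamma (m + 1 + n + ν + 1) = (m + n + ν + 1) * Real.Gamma (m + n + ν + 1) := by
      rw [← Real.Gamma_add_one (by linarith)]
      ring_nf
    have p1 : Real.Gamma (m + ν + 1) ≠ 0 := (Real.Gamma_pos_of_pos (by linarith)).ne'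
    have p2 : Real.Gamma (n + ν + 1) ≠ 0 := (Real.Gamma_pos_of_pos (by linarith)).ne'
    have p3 : (m : ℝ) + ν + 1 ≠ 0 := by linarith
    have second : ∑ k ∈ Finset.range (m + 1), (m.choose k : ℝ) *
          ((n.choose (k + 1) : ℝ) * (k + 1).factorial / Real.Gamma (k + (ν + 1) + 1))
        = n * (Real.Gamma (m + n + ν + 1) /
          (Real.Gamma (m + 1 + ν + 1) * Real.Gamma (n + ν + 1))) := by
      cases n with
      | zero => simp
      | succ n =>
        have h3 := ih n (ν + 1) (by linarith)
        push_cast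
        rw [show (m : ℝ) + (n + 1) + ν + 1 = m + n + (ν + 1) + 1 by ring,
          show (m : ℝ) + 1 + ν + 1 = m + (ν + 1) + 1 by ring,
          show (n : ℝ) + 1 + ν + 1 = n + (ν + 1) + 1 by ring, ← h3, Finset.mul_sum]
        refine Finset.sum_congr rfl fun k _ => ?_
        have h4 : ((n : ℝ) + 1) * n.choose k = (n + 1).choose (k + 1) * (k + 1) := by
          exact_mod_cast Nat.add_one_mul_choose_eq n k
        rw [Nat.factorial_succ]
        push_cast
        rw [← mul_assoc _ ((k : ℝ) + 1), ← h4]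
        ring
    rw [second]
    push_cast
    rw [hG, hG']
    field_simp
    ring

theorem exists_pos_le_Gamma_nat_add {ν : ℝ} (hν : -1 < ν) :
    ∃ c : ℝ, 0 < c ∧ ∀ k : ℕ, c ≤ Real.Gamma (k + ν + 1) := by
  refine ⟨min (Real.Gamma (ν + 1)) (Real.Gamma (ν + 2)), lt_min
    (Real.Gamma_pos_of_pos (by linarith)) (Real.Gamma_pos_of_pos (by linarith)), fun k => ?_⟩
  rcases k with _ | k
  · simp
  · refine (min_le_right _ _).trans ?_
    induction k with
    | zero => exact le_of_eq (by congr 1; push_cast; ring)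
    | succ k ih =>
      have hk : (0 : ℝ) ≤ k := k.cast_nonneg
      push_cast at ih ⊢
      rw [show (k : ℝ) + 1 + 1 + ν + 1 = (k + 1 + ν + 1) + 1 by ring,
        Real.Gamma_add_one (by linarith)]
      have := Real.Gamma_pos_of_pos (show (0 : ℝ) < k + 1 + ν + 1 by linarith)
      nlinarith

theorem summable_pow_div_factorial_mul_Gamma {ν : ℝ} (hν : -1 < ν) (z : ℝ) :
    Summable fun k : ℕ => z ^ k / (k.factorial * Real.Gamma (k + ν + 1)) := by
  obtain ⟨c, hc, h⟩ := exists_pos_le_Gamma_nat_add hν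
  refine Summable.of_norm_bounded
    ((Real.summable_pow_div_factorial |z|).mul_right c⁻¹) fun k => ?_
  have hk : 0 < (k.factorial : ℝ) := by positivity
  rw [norm_div, norm_mul, norm_pow, Real.norm_eq_abs, Real.norm_of_nonneg hk.le,
    Real.norm_of_nonneg (hc.le.trans (h k)), ← div_div, div_eq_mul_inv]
  gcongr
  exact h k

theorem HasSum.mul_prod_real {ι κ : Type*} {f : ι → ℝ} {g : κ → ℝ} {s t : ℝ} (hf : HasSum f s)
    (hg : HasSum g t) : HasSum (fun p : ι × κ => f p.1 * g p.2) (s * t) :=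
  hf.mul hg (summable_mul_of_summable_norm hf.summable.norm hg.summable.norm)

/-- The double power series of `exp (a + b) * ∑ k, (a * b) ^ k / (k ! * Γ (k + ν + 1))`. -/
theorem hasSum_Gamma_mul_pow_mul_pow {ν : ℝ} (hν : -1 < ν) (a b : ℝ) :
    HasSum (fun p : ℕ × ℕ => a ^ p.1 / (p.1.factorial * Real.Gamma (p.1 + ν + 1))
        * (b ^ p.2 / (p.2.factorial * Real.Gamma (p.2 + ν + 1)))
        * Real.Gamma (p.1 + p.2 + ν + 1))
      (Real.exp (a + b) * ∑' k : ℕ, (a * b) ^ k / (k.factorial * Real.Gamma (k + ν + 1))) := by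
  have ea (a : ℝ) : HasSum (fun i : ℕ => a ^ i / i.factorial) (Real.exp a) := by
    rw [Real.exp_eq_exp_ℝ]
    exact NormedSpace.expSeries_div_hasSum_exp a
  have hE : HasSum (fun p : ℕ × ℕ => a ^ p.1 / p.1.factorial * (b ^ p.2 / p.2.factorial))
      (Real.exp a * Real.exp b) :=
    (ea a).mul_prod_real (ea b)
  have hw := summable_pow_div_factorial_mul_Gamma hν (a * b)
  have hT := hE.mul_prod_real hw.hasSum
  rw [← Real.exp_add] at hT
  let e : (ℕ × ℕ) × ℕ → (ℕ × ℕ) × ℕ := fun q => ((q.1.1 + q.2, q.1.2 + q.2), q.2)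
  have he : Function.Injective e := by
    rintro ⟨⟨i, j⟩, k⟩ ⟨⟨i', j'⟩, k'⟩ h
    simp only [e, Prod.mk.injEq] at h ⊢
    omega
  let G : (ℕ × ℕ) × ℕ → ℝ := fun q => a ^ q.1.1 / q.1.1.factorial
    * (b ^ q.1.2 / q.1.2.factorial) * ((q.1.1.choose q.2 : ℝ)
    * ((q.1.2.choose q.2 : ℝ) * q.2.factorial / Real.Gamma (q.2 + ν + 1)))
  have hG : HasSum G (Real.exp (a + b) *
      ∑' k : ℕ, (a * b) ^ k / (k.factorial * Real.Gamma (k + ν + 1))) := by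
    refine (he.hasSum_iff ?_).1 ?_
    · rintro ⟨⟨m, n⟩, k⟩ hq
      by_cases hm : m < k
      · simp [G, Nat.choose_eq_zero_of_lt hm]
      by_cases hn : n < k
      · simp [G, Nat.choose_eq_zero_of_lt hn]
      exact absurd ⟨((m - k, n - k), k), by
        simp [e, Nat.sub_add_cancel (not_lt.1 hm), Nat.sub_add_cancel (not_lt.1 hn)]⟩ hq
    · convert hT using 1
      ext ⟨⟨i, j⟩, k⟩
      have hk := Real.Gamma_pos_of_pos
        (show (0 : ℝ) < k + ν + 1 by have : (0 : ℝ) ≤ k := k.cast_nonneg; linarith)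
      have hchoose (l : ℕ) : ((l + k).choose k : ℝ)
          = (l + k).factorial / (l.factorial * k.factorial) := by
        rw [← Nat.choose_symm_add, Nat.cast_add_choose]
      simp only [G, e, Function.comp, hchoose, mul_pow, pow_add]
      field_simp
  refine hG.prod_fiberwise fun p => ?_
  obtain ⟨m, n⟩ := p
  have : HasSum (fun k => G ((m, n), k)) (∑ k ∈ Finset.range (m + 1), G ((m, n), k)) := by
    refine hasSum_sum_of_ne_finset_zero fun k hk => ?_
    have : m < k := not_le.1 fun h => hk (Finset.mem_range_succ_iff.2 h)
    simp [G, Nat.choose_eq_zero_of_lt this]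
  convert this using 1
  simp only [G, ← Finset.mul_sum]
  rw [sum_choose_mul_choose_div_Gamma m n ν hν]
  field_simp

theorem besselJ_two_mul_sqrt (ν : ℝ) {z : ℝ} (hz : 0 < z) :
    besselJ ν (2 * √z)
      = z ^ (ν / 2) * ∑' k : ℕ, (-z) ^ k / (k.factorial * Real.Gamma (k + ν + 1)) := by
  rw [besselJ, ← tsum_mul_left]
  refine tsum_congr fun k => ?_
  rw [mul_div_cancel_left₀ _ two_ne_zero, pow_mul, Real.sq_sqrt hz.le, Real.sqrt_eq_rpow,
    ← Real.rpow_mul hz.le, neg_pow z, one_div_mul_eq_div]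
  ring

theorem besselI_two_mul (ν z : ℝ) :
    besselI ν (2 * z)
      = z ^ ν * ∑' k : ℕ, (z ^ 2) ^ k / (k.factorial * Real.Gamma (k + ν + 1)) := by
  rw [besselI, ← tsum_mul_left]
  refine tsum_congr fun k => ?_
  rw [mul_div_cancel_left₀ _ two_ne_zero, pow_mul]
  ring

theorem integral_rpow_nat_add_mul_exp {ν ε : ℝ} (hν : -1 < ν) (hε : 0 < ε) (k : ℕ) :
    ∫ s in Set.Ioi (0 : ℝ), s ^ (k + ν) * Real.exp (-ε * s)
      = ε⁻¹ ^ k * ε⁻¹ ^ (ν + 1) * Real.Gamma (k + ν + 1) := by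
  have hk : (0 : ℝ) ≤ k := k.cast_nonneg
  have := Real.integral_rpow_mul_exp_neg_mul_Ioi (a := k + ν + 1) (by linarith) hε
  simp only [add_sub_cancel_right, one_div, ← neg_mul] at this
  rw [this, add_assoc (k : ℝ), Real.rpow_add (inv_pos.2 hε), Real.rpow_natCast]

theorem integrableOn_rpow_nat_add_mul_exp {ν ε : ℝ} (hν : -1 < ν) (hε : 0 < ε) (k : ℕ) :
    IntegrableOn (fun s : ℝ => s ^ (k + ν) * Real.exp (-ε * s)) (Set.Ioi 0) := by
  have hk : (0 : ℝ) ≤ k := k.cast_nonneg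
  exact integrableOn_rpow_mul_exp_neg_mul_rpow (s := k + ν) (by linarith) one_pos hε |>.congr_fun
    (fun s _ => by simp) measurableSet_Ioi

theorem stmt11 (ν : ℝ) (hν : -1 < ν) (x y ε : ℝ) (hx : 0 < x) (hy : 0 < y) (hε : 0 < ε) :
    ∫ s in Set.Ioi (0 : ℝ),
        besselJ ν (2 * Real.sqrt (x * s)) * besselJ ν (2 * Real.sqrt (y * s))
          * Real.exp (-ε * s)
      = (1 / ε) * Real.exp (-(x + y) / ε) * besselI ν (2 * Real.sqrt (x * y) / ε) := by
  let c (z : ℝ) (k : ℕ) : ℝ := z ^ k / (k.factorial * Real.Gamma (k + ν + 1))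
  let F (p : ℕ × ℕ) (s : ℝ) : ℝ :=
    c (-x) p.1 * c (-y) p.2 * (s ^ (((p.1 + p.2 : ℕ) : ℝ) + ν) * Real.exp (-ε * s))
  have hF (p) : Integrable (F p) (volume.restrict (Set.Ioi 0)) :=
    (integrableOn_rpow_nat_add_mul_exp hν hε _).const_mul _
  have hscale (a b : ℝ) (p : ℕ × ℕ) :
      c a p.1 * c b p.2 * ∫ s in Set.Ioi (0 : ℝ),
          s ^ (((p.1 + p.2 : ℕ) : ℝ) + ν) * Real.exp (-ε * s)
        = ε⁻¹ ^ (ν + 1) * (c (a / ε) p.1 * c (b / ε) p.2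
          * Real.Gamma (p.1 + p.2 + ν + 1)) := by
    rw [integral_rpow_nat_add_mul_exp hν hε]
    simp only [c, div_pow, pow_add, inv_pow]
    push_cast
    ring
  have habs (z : ℝ) (hz : 0 < z) (k : ℕ) : |c (-z) k| = c z k := by
    have hk := Real.Gamma_pos_of_pos
      (show (0 : ℝ) < k + ν + 1 by have : (0 : ℝ) ≤ k := k.cast_nonneg; linarith)
    simp only [c, abs_div, abs_pow, abs_neg, abs_of_pos hz]
    rw [abs_of_pos (by positivity)]
  have hsum : Summable fun p => ∫ s in Set.Ioi (0 : ℝ), ‖F p s‖ := by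
    refine ((hasSum_Gamma_mul_pow_mul_pow hν (x / ε) (y / ε)).summable.mul_left
      (ε⁻¹ ^ (ν + 1))).congr fun p => ?_
    rw [← hscale x y p, ← integral_const_mul]
    refine setIntegral_congr_fun measurableSet_Ioi fun s (hs : 0 < s) => ?_
    simp only [F, norm_mul, Real.norm_eq_abs, habs x hx, habs y hy, Real.abs_exp]
    rw [abs_of_pos (Real.rpow_pos_of_pos hs _)]
  have hint := hasSum_integral_of_summable_integral_norm hF hsum
  have hval : ∫ s in Set.Ioi (0 : ℝ), ∑' p, F p s
      = ε⁻¹ ^ (ν + 1) * (Real.exp (-x / ε + -y / ε) *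
        ∑' k : ℕ, c (-x / ε * (-y / ε)) k) := by
    refine hint.unique (((hasSum_Gamma_mul_pow_mul_pow hν (-x / ε) (-y / ε)).mul_left
      (ε⁻¹ ^ (ν + 1))).congr_fun fun p => ?_)
    rw [← hscale (-x) (-y) p, ← integral_const_mul]
  have hpt : ∀ s ∈ Set.Ioi (0 : ℝ),
      besselJ ν (2 * Real.sqrt (x * s)) * besselJ ν (2 * Real.sqrt (y * s)) * Real.exp (-ε * s)
        = √(x * y) ^ ν * ∑' p, F p s := by
    intro s (hs : 0 < s)
    have hxs := summable_pow_div_factorial_mul_Gamma hν (-(x * s))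
    have hys := summable_pow_div_factorial_mul_Gamma hν (-(y * s))
    have hr : (x * s) ^ (ν / 2) * (y * s) ^ (ν / 2) = √(x * y) ^ ν * s ^ ν := by
      rw [Real.sqrt_eq_rpow, ← Real.rpow_mul (by positivity), one_div_mul_eq_div,
        Real.mul_rpow hx.le hs.le, Real.mul_rpow hy.le hs.le, Real.mul_rpow hx.le hy.le]
      rw [show s ^ ν = s ^ (ν / 2) * s ^ (ν / 2) by rw [← Real.rpow_add hs, add_halves]]
      ring
    rw [besselJ_two_mul_sqrt ν (mul_pos hx hs), besselJ_two_mul_sqrt ν (mul_pos hy hs),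
      mul_mul_mul_comm, hr, tsum_mul_tsum_of_summable_norm hxs.norm hys.norm, mul_assoc,
      mul_assoc, mul_left_comm, ← tsum_mul_right, ← tsum_mul_left, ← tsum_mul_left,
      ← tsum_mul_left]
    refine tsum_congr fun p => ?_
    simp only [F, c]
    rw [Real.rpow_add hs, Real.rpow_natCast, ← neg_mul, ← neg_mul, mul_pow, mul_pow, pow_add]
    ring
  rw [setIntegral_congr_fun measurableSet_Ioi hpt, integral_const_mul, hval, mul_div_assoc,
    besselI_two_mul, div_pow, Real.sq_sqrt (by positivity), Real.div_rpow (by positivity) hε.le,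
    Real.rpow_add (inv_pos.2 hε), Real.rpow_one, Real.inv_rpow hε.le,
    show -x / ε * (-y / ε) = x * y / ε ^ 2 by field_simp,
    show -x / ε + -y / ε = -(x + y) / ε by ring]
  simp only [c]
  ring
end
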